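/- arXiv:0801.3283 — 9 statements merged into one kernel-verified Lean document; each statement's English description precedes it below -/
import Mathlib

section
/- Let ω > 0 be a real number and let t, s be real numbers with sin(ωt) ≠ 0. Then (1/2)·cot(ωt/2)·((sin(ω(t−s)) + sin(ωs))/sin(ωt))² − cos(ωs)·sin(ωs) + cot(ωt)·sin²(ωs) = (1/2)·cot(ωt/2). -/
/-- The key trigonometric simplification in the computation of the linear term of the
wave invariants: for `ω > 0` and `sin (ω t) ≠ 0`,
`(1/2)·cot(ωt/2)·((sin(ω(t−s)) + sin(ωs))/sin(ωt))² − cos(ωs)·sin(ωs) + cot(ωt)·sin²(ωs)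
  = (1/2)·cot(ωt/2)`. -/
theorem stmt_0 (ω t s : ℝ) (hω : 0 < ω) (h : Real.sin (ω * t) ≠ 0) :
    (1 / 2) * (Real.cos (ω * t / 2) / Real.sin (ω * t / 2)) *
        ((Real.sin (ω * (t - s)) + Real.sin (ω * s)) / Real.sin (ω * t)) ^ 2
      - Real.cos (ω * s) * Real.sin (ω * s)
      + (Real.cos (ω * t) / Real.sin (ω * t)) * (Real.sin (ω * s)) ^ 2
    = (1 / 2) * (Real.cos (ω * t / 2) / Real.sin (ω * t / 2)) := by
  obtain ⟨a, ha⟩ : ∃ a, ω * t = 2 * a := ⟨ω * t / 2, by ring⟩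
  have hsub : ω * (t - s) = 2 * a - ω * s := by rw [← ha]; ring
  have hhalf : ω * t / 2 = a := by rw [ha]; ring
  rw [hhalf, hsub, ha]
  rw [ha, Real.sin_two_mul] at h
  have hsin : Real.sin a ≠ 0 := fun h0 => h (by simp [h0])
  have hcos : Real.cos a ≠ 0 := fun h0 => h (by simp [h0])
  have ha2 := Real.sin_sq_add_cos_sq a
  have hs2 := Real.sin_sq_add_cos_sq (ω * s)
  have hratio : (Real.sin (2 * a - ω * s) + Real.sin (ω * s)) / Real.sin (2 * a)
      = Real.cos (a - ω * s) / Real.cos a := by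
    rw [Real.sin_sub, Real.cos_sub, Real.sin_two_mul, Real.cos_two_mul,
      div_eq_div_iff h hcos]
    linear_combination 2 * Real.sin (ω * s) * Real.cos a * (-ha2)
  rw [hratio, Real.cos_sub, Real.sin_two_mul, Real.cos_two_mul]
  field_simp
  linear_combination Real.sin (ω * s) ^ 2 * ha2 + Real.cos a ^ 2 * hs2
end

section
/- Let n ≥ 1 and let ω₁, …, ωₙ > 0 and ω'₁, …, ω'ₙ > 0 be real numbers such that Πₖ sin(ωₖ t/2) = Πₖ sin(ω'ₖ t/2) for all t ∈ ℝ. Then there is a permutation σ of {1, …, n} with ω'ₖ = ω_{σ(k)} for every k. -/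
open scoped BigOperators

lemma dense_setOf_sin_mul_div_two_ne_zero {a : ℝ} (ha : 0 < a) :
    Dense {t : ℝ | Real.sin (a * t / 2) ≠ 0} := by
  have hc : {t : ℝ | Real.sin (a * t / 2) = 0}.Countable := by
    refine (Set.countable_range fun m : ℤ => 2 * (m * Real.pi) / a).mono ?_
    intro t ht
    obtain ⟨m, hm⟩ := Real.sin_eq_zero_iff.mp ht
    refine ⟨m, ?_⟩
    simp only [hm]
    field_simp
  exact hc.dense_compl ℝ

/-- If `s` and `t` have the same sine product, every element of `s` is bounded by an element
of `t`. -/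
lemma exists_le_of_prod_sin_eq {s t : Multiset ℝ} (hs : ∀ x ∈ s, 0 < x) (ht : ∀ x ∈ t, 0 < x)
    (h : ∀ r : ℝ, (s.map fun x => Real.sin (x * r / 2)).prod =
      (t.map fun x => Real.sin (x * r / 2)).prod) {a : ℝ} (ha : a ∈ s) :
    ∃ b ∈ t, a ≤ b := by
  have ha0 := hs a ha
  have hzero : (s.map fun x => Real.sin (x * (2 * Real.pi / a) / 2)).prod = 0 := by
    refine Multiset.prod_eq_zero (Multiset.mem_map.mpr ⟨a, ha, ?_⟩)
    rw [show a * (2 * Real.pi / a) / 2 = Real.pi by field_simp, Real.sin_pi]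
  rw [h, Multiset.prod_eq_zero_iff, Multiset.mem_map] at hzero
  obtain ⟨b, hb, hsin⟩ := hzero
  refine ⟨b, hb, ?_⟩
  obtain ⟨m, hm⟩ := Real.sin_eq_zero_iff.mp hsin
  have hb0 := ht b hb
  have hmb : (m : ℝ) * a = b := by
    have := Real.pi_pos
    field_simp at hm
    linarith
  have hm0 : (0 : ℝ) < m := pos_of_mul_pos_left (hmb ▸ hb0) ha0.le
  have hm1 : (1 : ℝ) ≤ m := by
    exact_mod_cast Int.add_one_le_iff.mpr (Int.cast_pos.mp hm0)
  nlinarith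

lemma exists_mem_forall_le_of_ne_zero {s : Multiset ℝ} (hs : s ≠ 0) :
    ∃ a ∈ s, ∀ x ∈ s, x ≤ a := by
  obtain ⟨a, ha, hmax⟩ := s.toFinset.exists_max_image id (Multiset.toFinset_nonempty.mpr hs)
  exact ⟨a, Multiset.mem_toFinset.mp ha, fun x hx => hmax x (Multiset.mem_toFinset.mpr hx)⟩

/-- A multiset of positive frequencies is determined by the product of its sines. -/
theorem Multiset.eq_of_prod_sin_eq (s t : Multiset ℝ) (hs : ∀ x ∈ s, 0 < x)
    (ht : ∀ x ∈ t, 0 < x)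
    (h : ∀ r : ℝ, (s.map fun x => Real.sin (x * r / 2)).prod =
      (t.map fun x => Real.sin (x * r / 2)).prod) : s = t := by
  induction hn : s.card generalizing s t with
  | zero =>
    obtain rfl := Multiset.card_eq_zero.mp hn
    by_contra hne
    obtain ⟨b, hb⟩ := Multiset.exists_mem_of_ne_zero (Ne.symm hne)
    obtain ⟨c, hc, -⟩ := exists_le_of_prod_sin_eq ht hs (fun r => (h r).symm) hb
    exact Multiset.notMem_zero c hc
  | succ n ih =>
    have hs0 : s ≠ 0 := by rintro rfl; simp at hn
    obtain ⟨a, ha, hamax⟩ := exists_mem_forall_le_of_ne_zero hs0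
    obtain ⟨b, hb, hab⟩ := exists_le_of_prod_sin_eq hs ht h ha
    obtain ⟨c, hc, hbc⟩ := exists_le_of_prod_sin_eq ht hs (fun r => (h r).symm) hb
    obtain rfl : a = b := le_antisymm hab (hbc.trans (hamax c hc))
    obtain ⟨u, rfl⟩ := Multiset.exists_cons_of_mem ha
    obtain ⟨v, rfl⟩ := Multiset.exists_cons_of_mem hb
    congr 1
    refine ih u v (fun x hx => hs x (Multiset.mem_cons_of_mem hx))
      (fun x hx => ht x (Multiset.mem_cons_of_mem hx)) ?_ (by simpa using hn)
    refine congrFun (Continuous.ext_on (dense_setOf_sin_mul_div_two_ne_zero (hs a ha))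
      (continuous_multiset_prod _ fun _ _ => by fun_prop)
      (continuous_multiset_prod _ fun _ _ => by fun_prop) fun r hr => ?_)
    have hr' := h r
    simp only [Multiset.map_cons, Multiset.prod_cons] at hr'
    exact mul_left_cancel₀ hr hr'

lemma exists_perm_of_map_univ_eq {ι α : Type*} [Fintype ι] {f g : ι → α}
    (h : Finset.univ.val.map f = Finset.univ.val.map g) :
    ∃ σ : Equiv.Perm ι, ∀ i, f i = g (σ i) := by
  classical
  have hcard (c : α) : Fintype.card {i // f i = c} = Fintype.card {i // g i = c} := by
    have hc := congrArg (Multiset.count c) h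
    simp only [Multiset.count_map, eq_comm (a := c)] at hc
    simp only [Fintype.card_subtype]
    exact hc
  exact ⟨Equiv.ofFiberEquiv fun c => Fintype.equivOfCardEq (hcard c),
    fun i => (Equiv.ofFiberEquiv_map _ i).symm⟩

/-- If two families of positive frequencies `ω`, `ω'` satisfy
`Πₖ sin(ωₖ t/2) = Πₖ sin(ω'ₖ t/2)` for all real `t`, then they coincide up to a
permutation of the indices. -/
theorem stmt_4 (n : ℕ) (hn : 1 ≤ n) (ω ω' : Fin n → ℝ)
    (hω : ∀ k, 0 < ω k) (hω' : ∀ k, 0 < ω' k)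
    (h : ∀ t : ℝ, ∏ k, Real.sin (ω k * t / 2) = ∏ k, Real.sin (ω' k * t / 2)) :
    ∃ σ : Equiv.Perm (Fin n), ∀ k, ω' k = ω (σ k) := by
  have hmap : Finset.univ.val.map ω' = Finset.univ.val.map ω := by
    refine Multiset.eq_of_prod_sin_eq _ _ (by simpa using hω') (by simpa using hω) fun r => ?_
    simp only [Multiset.map_map]
    exact (h r).symm
  exact exists_perm_of_map_univ_eq hmap
end

section
/- Let ω₁, …, ωₙ > 0 be linearly independent over ℚ (i.e., if q₁, …, qₙ ∈ ℚ and Σₖ qₖωₖ = 0 then all qₖ = 0). Then the set {(cot(ω₁t/2), …, cot(ωₙt/2)) : t ∈ ℝ, sin(ωₖt/2) ≠ 0 for all k} is dense in ℝⁿ. -/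
open scoped BigOperators

open MeasureTheory UnitAddTorus

lemma UnitAddTorus.mFourier_apply_add {d : Type*} [Fintype d] (m : d → ℤ)
    (x y : UnitAddTorus d) : mFourier m (x + y) = mFourier m x * mFourier m y := by
  simp only [mFourier, ContinuousMap.coe_mk, Pi.add_apply, fourier_apply, smul_add,
    AddCircle.toCircle_add, Circle.coe_mul, Finset.prod_mul_distrib]

/-- A character of the torus, restricted to a subgroup on which it is not
trivial, has vanishing integral against an invariant measure. -/
lemma UnitAddTorus.integral_mFourier_subgroup_eq_zero {d : Type*} [Fintype d]
    (H : AddSubgroup (UnitAddTorus d)) [MeasurableSpace H] [BorelSpace H]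
    (μ : Measure H) [μ.IsAddLeftInvariant] {m : d → ℤ} {h : UnitAddTorus d} (hh : h ∈ H)
    (hm : mFourier m h ≠ 1) : ∫ y : H, mFourier m (y : UnitAddTorus d) ∂μ = 0 := by
  have key := integral_add_left_eq_self (μ := μ)
    (fun y : H => mFourier m (y : UnitAddTorus d)) ⟨h, hh⟩
  simp only [AddSubgroup.coe_add, mFourier_apply_add, integral_const_mul] at key
  by_contra h0
  exact hm (mul_right_cancel₀ h0 (key.trans (one_mul _).symm))

/-- A closed subgroup of the torus which is not contained in the kernel of any nontrivial
character is the whole torus. -/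
theorem UnitAddTorus.addSubgroup_eq_top_of_mFourier_ne_one {d : Type*} [Fintype d]
    (H : AddSubgroup (UnitAddTorus d)) (hH : IsClosed (H : Set (UnitAddTorus d)))
    (hchar : ∀ m : d → ℤ, m ≠ 0 → ∃ h ∈ H, mFourier m h ≠ 1) : H = ⊤ := by
  let : MeasurableSpace H := borel H
  have : BorelSpace H := ⟨rfl⟩
  have : CompactSpace H := isCompact_iff_compactSpace.mp hH.isCompact
  let μ : Measure H := Measure.addHaar
  have hint (f : C(UnitAddTorus d, ℂ)) (a : UnitAddTorus d) :
      Integrable (fun y : H => f (a + y)) μ :=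
    (by fun_prop : Continuous fun y : H => f (a + y)).integrable_of_hasCompactSupport
      (HasCompactSupport.of_compactSpace _)
  have translate (a : UnitAddTorus d) (f : C(UnitAddTorus d, ℂ)) :
      ∫ y : H, f (a + y) ∂μ = ∫ y : H, f (0 + y) ∂μ := by
    let L (a : UnitAddTorus d) : C(UnitAddTorus d, ℂ) →L[ℂ] ℂ :=
      LinearMap.mkContinuous
        { toFun := fun f => ∫ y : H, f (a + y) ∂μ
          map_add' := fun f g => integral_add (hint f a) (hint g a)
          map_smul' := fun c f => integral_const_mul c _ } (μ.real Set.univ) fun f => by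
        rw [mul_comm]
        exact norm_integral_le_of_norm_le_const (Filter.Eventually.of_forall fun y =>
          f.norm_coe_le_norm _)
    have hdense : Dense (Submodule.span ℂ (Set.range (mFourier (d := d))) :
        Set C(UnitAddTorus d, ℂ)) :=
      Submodule.dense_iff_topologicalClosure_eq_top.mpr span_mFourier_closure_eq_top
    have hL : L a = L 0 := by
      refine ContinuousLinearMap.ext_on hdense ?_
      rintro _ ⟨m, rfl⟩
      change ∫ y : H, mFourier m (a + y) ∂μ = ∫ y : H, mFourier m (0 + y) ∂μ
      rcases eq_or_ne m 0 with rfl | hm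
      · simp [mFourier_zero]
      · obtain ⟨h, hh, hne⟩ := hchar m hm
        simp only [mFourier_apply_add, integral_const_mul,
          integral_mFourier_subgroup_eq_zero H μ hh hne, mul_zero]
    exact congrArg (fun T => T f) hL
  rw [eq_top_iff]
  intro x _
  by_contra hx
  obtain ⟨f, hf0, hf1, hf⟩ := exists_continuous_zero_one_of_isClosed hH
    (isClosed_singleton (x := x)) (Set.disjoint_singleton_right.mpr hx)
  have hzero : ∫ y : H, f (x + y) ∂μ = 0 := by
    have := translate x ⟨fun z => (f z : ℂ), by fun_prop⟩
    simp only [ContinuousMap.coe_mk, zero_add, integral_complex_ofReal,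
      Complex.ofReal_inj] at this
    rw [this]
    simp [fun y : H => hf0 y.2]
  have hcont : Continuous fun y : H => f (x + y) := by fun_prop
  have hpos : 0 < ∫ y : H, f (x + y) ∂μ :=
    hcont.integral_pos_of_hasCompactSupport_nonneg_nonzero (HasCompactSupport.of_compactSpace _)
      (fun y => (hf _).1) (x := 0) (by simp [hf1 rfl])
  exact hpos.ne' hzero

/-- Kronecker's theorem: the line through the origin of the torus with rationally independent
slopes is dense. -/
theorem UnitAddTorus.denseRange_line {d : Type*} [Fintype d] (ω : d → ℝ)
    (hind : ∀ m : d → ℤ, ∑ k, (m k : ℝ) * ω k = 0 → m = 0) :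
    DenseRange fun t : ℝ => (fun k => ((ω k * t : ℝ) : UnitAddCircle) : UnitAddTorus d) := by
  let φ : ℝ →+ UnitAddTorus d :=
    { toFun := fun t k => ((ω k * t : ℝ) : UnitAddCircle)
      map_zero' := by ext; simp
      map_add' := fun s t => by ext k; simp [mul_add] }
  have htop : φ.range.topologicalClosure = ⊤ := by
    refine addSubgroup_eq_top_of_mFourier_ne_one _ (AddSubgroup.isClosed_topologicalClosure _) ?_
    intro m hm
    set c : ℝ := ∑ k, (m k : ℝ) * ω k with hc
    have hc0 : c ≠ 0 := fun h => hm (hind m h)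
    refine ⟨φ (1 / (2 * c)), AddSubgroup.le_topologicalClosure _ ⟨_, rfl⟩, ?_⟩
    have : mFourier m (φ (1 / (2 * c))) = -1 := by
      change ∏ k, fourier (m k) ((ω k * (1 / (2 * c)) : ℝ) : UnitAddCircle) = -1
      simp only [fourier_coe_apply, ← Complex.exp_sum]
      rw [← Complex.exp_pi_mul_I]
      congr 1
      have hc' : (c : ℂ) ≠ 0 := by exact_mod_cast hc0
      have hcc : (c : ℂ) = ∑ k, (m k : ℂ) * ω k := by rw [hc]; push_cast; rfl
      calc _ = ∑ k, (Real.pi * Complex.I / c) * ((m k : ℂ) * ω k) := by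
            refine Finset.sum_congr rfl fun k _ => ?_
            push_cast
            field_simp
        _ = _ := by
            rw [← Finset.mul_sum, ← hcc]
            field_simp
    rw [this]
    norm_num
  intro x
  have : x ∈ φ.range.topologicalClosure := htop ▸ AddSubgroup.mem_top x
  exact this

/-- If `ω₁, …, ωₙ > 0` are linearly independent over `ℚ`, then the set of points
`(cot(ω₁t/2), …, cot(ωₙt/2))`, for `t ∈ ℝ` with `sin(ωₖt/2) ≠ 0` for all `k`,
is dense in `ℝⁿ`. Here `cot θ = cos θ / sin θ`. -/
theorem stmt_6 (n : ℕ) (ω : Fin n → ℝ) (hω : ∀ k, 0 < ω k)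
    (hind : ∀ q : Fin n → ℚ, (∑ k, (q k : ℝ) * ω k) = 0 → ∀ k, q k = 0) :
    Dense {v : Fin n → ℝ |
      ∃ t : ℝ, (∀ k, Real.sin (ω k * t / 2) ≠ 0) ∧
        v = fun k => Real.cos (ω k * t / 2) / Real.sin (ω k * t / 2)} := by
  have hline := UnitAddTorus.denseRange_line ω fun m hm => funext fun k => by
    simpa using hind (fun k => (m k : ℚ)) (by simpa using hm) k
  rw [dense_iff_inter_open]
  rintro U hU ⟨v, hv⟩
  let S : Set (Fin n → ℝ) := {x | ∀ k, Real.sin (x k * Real.pi) ≠ 0}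
  let g : (Fin n → ℝ) → Fin n → ℝ := fun x k =>
    Real.cos (x k * Real.pi) / Real.sin (x k * Real.pi)
  have hS : IsOpen S := by
    simp only [S, Set.ofPred_forall]
    exact isOpen_iInter_of_finite fun k =>
      isOpen_ne_fun (by fun_prop) continuous_const
  have hg : ContinuousOn g S := continuousOn_pi.mpr fun k =>
    ContinuousOn.div (by fun_prop) (by fun_prop) fun x hx => hx k
  have hopen : IsOpen (S ∩ g ⁻¹' U) := hg.isOpen_inter_preimage hS hU
  have hne : (S ∩ g ⁻¹' U).Nonempty := by
    have hangle (k : Fin n) : (Real.pi / 2 - Real.arctan (v k)) / Real.pi * Real.pi =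
        Real.pi / 2 - Real.arctan (v k) := div_mul_cancel₀ _ Real.pi_ne_zero
    refine ⟨fun k => (Real.pi / 2 - Real.arctan (v k)) / Real.pi, fun k => ?_, ?_⟩
    · rw [hangle, Real.sin_pi_div_two_sub]
      exact (Real.cos_arctan_pos _).ne'
    · rw [Set.mem_preimage]
      convert hv using 1
      funext k
      simp only [g]
      rw [hangle, Real.sin_pi_div_two_sub, Real.cos_pi_div_two_sub, ← Real.tan_eq_sin_div_cos,
        Real.tan_arctan]
  have hmk : IsOpenMap (Pi.map fun (_ : Fin n) (x : ℝ) => (x : UnitAddCircle)) :=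
    IsOpenMap.piMap (fun _ => QuotientAddGroup.isOpenMap_coe) (by simp)
  obtain ⟨s, x, ⟨hxS, hxU⟩, hxs⟩ := hline.exists_mem_open (hmk _ hopen) (hne.image _)
  have hshift (k : Fin n) : ∃ m : ℤ, x k = ω k * s + m := by
    have hk : (x k : UnitAddCircle) = (ω k * s : ℝ) := congrFun hxs k
    rw [← sub_eq_zero, ← AddCircle.coe_sub, AddCircle.coe_eq_zero_iff] at hk
    obtain ⟨m, hm⟩ := hk
    exact ⟨m, by rw [zsmul_one] at hm; linarith⟩
  choose m hm using hshift
  have hx (k : Fin n) : x k * Real.pi = ω k * (2 * Real.pi * s) / 2 + m k * Real.pi := by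
    rw [hm k]; ring
  refine ⟨g x, hxU, 2 * Real.pi * s, fun k h0 => hxS k ?_, funext fun k => ?_⟩
  · rw [hx, Real.sin_add_int_mul_pi, h0, mul_zero]
  · simp only [g]
    rw [hx, Real.sin_add_int_mul_pi, Real.cos_add_int_mul_pi,
      mul_div_mul_left _ _ (zpow_ne_zero _ (by norm_num))]
end

section
/- Let ω₁, …, ωₙ > 0 be linearly independent over ℚ. Let c : ℕⁿ → ℂ be a finitely supported function such that Σ_{α ∈ ℕⁿ} c(α) · Πₖ cot(ωₖt/2)^{αₖ} = 0 for every t ∈ ℝ with sin(ωₖt/2) ≠ 0 for all k. Then c(α) = 0 for every α ∈ ℕⁿ. -/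
open scoped BigOperators

open MvPolynomial in
/-- Exponentials whose frequencies are linearly independent over `ℚ` are algebraically
independent over `ℂ`. -/
theorem MvPolynomial.eq_zero_of_eval_exp_eq_zero {ι : Type*} [Fintype ι] (ω : ι → ℝ)
    (hind : ∀ q : ι → ℚ, (∑ k, (q k : ℝ) * ω k) = 0 → ∀ k, q k = 0)
    (P : MvPolynomial ι ℂ)
    (h : ∀ t : ℝ, eval (fun k => Complex.exp (Complex.I * (ω k * t))) P = 0) : P = 0 := by
  let χ : (ι →₀ ℕ) → (Multiplicative ℝ →* ℂ) := fun m =>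
    { toFun := fun t => Complex.exp (Complex.I * ((∑ k, (m k : ℝ) * ω k : ℝ) * t.toAdd))
      map_one' := by simp
      map_mul' := fun s t => by
        rw [← Complex.exp_add, toAdd_mul]
        push_cast
        ring_nf }
  have hχ : Function.Injective χ := by
    intro m m' hmm
    have hfreq : ∑ k, (m k : ℝ) * ω k = ∑ k, (m' k : ℝ) * ω k := by
      by_contra hne
      set a := ∑ k, (m k : ℝ) * ω k with ha
      set b := ∑ k, (m' k : ℝ) * ω k with hb
      have hab : (a : ℂ) - b ≠ 0 := by exact_mod_cast sub_ne_zero.mpr hne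
      have hval : Complex.exp (Complex.I * (a * (Real.pi / (a - b) : ℝ))) =
          Complex.exp (Complex.I * (b * (Real.pi / (a - b) : ℝ))) :=
        DFunLike.congr_fun hmm (Multiplicative.ofAdd (Real.pi / (a - b)))
      have hone : Complex.exp (Real.pi * Complex.I) = 1 := by
        rw [← div_eq_one_iff_eq (Complex.exp_ne_zero _), ← Complex.exp_sub] at hval
        rw [← hval]
        congr 1
        push_cast
        field_simp
      rw [Complex.exp_pi_mul_I] at hone
      norm_num at hone
    ext k
    have hk := hind (fun k => (m k : ℚ) - m' k) (by
      push_cast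
      simp only [sub_mul, Finset.sum_sub_distrib, hfreq, sub_self]) k
    exact_mod_cast sub_eq_zero.mp hk
  have hlin := (linearIndependent_monoidHom (Multiplicative ℝ) ℂ).comp χ hχ
  rw [linearIndependent_iff'] at hlin
  ext m
  by_cases hm : m ∈ P.support
  · refine hlin P.support (fun m => P.coeff m) ?_ m hm
    funext t
    rw [Pi.zero_apply, ← h t.toAdd, eval_eq', Finset.sum_apply]
    refine Finset.sum_congr rfl fun m _ => ?_
    simp only [Function.comp_apply, Pi.smul_apply, smul_eq_mul, ← Complex.exp_nat_mul,
      ← Complex.exp_sum]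
    congr 1
    change Complex.exp _ = _
    congr 1
    push_cast
    rw [Finset.sum_mul, Finset.mul_sum]
    exact Finset.sum_congr rfl fun k _ => by ring
  · simpa using hm

open MvPolynomial in
/-- Clearing denominators after the substitution `x ↦ I * (x + 1) / (x - 1)` in every variable. -/
theorem MvPolynomial.exists_eval_eq_mul_eval_cayley {ι : Type*} [Fintype ι]
    (P : MvPolynomial ι ℂ) :
    ∃ (N : ℕ) (Q : MvPolynomial ι ℂ), ∀ x : ι → ℂ,
      eval x Q = (∏ k, (x k - 1)) ^ (N + 1) *
        eval (fun k => Complex.I * (x k + 1) / (x k - 1)) P := by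
  classical
  induction P using MvPolynomial.induction_on with
  | C a => exact ⟨0, (∏ k, (X k - 1)) * C a, fun x => by simp [map_prod]⟩
  | add P P' hP hP' =>
    obtain ⟨N, Q, hQ⟩ := hP
    obtain ⟨N', Q', hQ'⟩ := hP'
    refine ⟨N + N', (∏ k, (X k - 1)) ^ N' * Q + (∏ k, (X k - 1)) ^ N * Q', fun x => ?_⟩
    simp only [map_add, map_mul, map_pow, map_prod, map_sub, eval_X, map_one, hQ, hQ']
    ring
  | mul_X P k hP =>
    obtain ⟨N, Q, hQ⟩ := hP
    refine ⟨N + 1, Q * (C Complex.I * (X k + 1) * ∏ j ∈ Finset.univ.erase k, (X j - 1)),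
      fun x => ?_⟩
    simp only [map_add, map_mul, map_prod, map_sub, eval_X, map_one, eval_C, hQ]
    rw [← Finset.mul_prod_erase _ _ (Finset.mem_univ k)]
    by_cases hx : x k - 1 = 0
    · simp [hx]
    · field_simp
      ring

/-- The Cayley transform of `exp (I * θ)` is `cot (θ / 2)`. -/
theorem Complex.cayley_exp_eq_cot (a t : ℝ) :
    Complex.I * (Complex.exp (Complex.I * (a * t)) + 1) /
        (Complex.exp (Complex.I * (a * t)) - 1) =
      ((Real.cos (a * t / 2) / Real.sin (a * t / 2) : ℝ) : ℂ) := by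
  have hcot := Complex.cot_eq_exp_ratio (a * t / 2 : ℂ)
  rw [show 2 * Complex.I * (a * t / 2 : ℂ) = Complex.I * (a * t) by ring, Complex.cot] at hcot
  push_cast
  rw [hcot, ← neg_sub (Complex.exp _) 1, mul_neg, div_neg, ← div_div, Complex.div_I]
  ring

open MvPolynomial in
/-- Cotangents whose frequencies are linearly independent over `ℚ` are algebraically
independent over `ℂ`. -/
theorem MvPolynomial.eq_zero_of_eval_cot_eq_zero {ι : Type*} [Fintype ι] (ω : ι → ℝ)
    (hind : ∀ q : ι → ℚ, (∑ k, (q k : ℝ) * ω k) = 0 → ∀ k, q k = 0)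
    (P : MvPolynomial ι ℂ)
    (h : ∀ t : ℝ, (∀ k, Real.sin (ω k * t / 2) ≠ 0) →
      eval (fun k => ((Real.cos (ω k * t / 2) / Real.sin (ω k * t / 2) : ℝ) : ℂ)) P = 0) :
    P = 0 := by
  obtain ⟨N, Q, hQ⟩ := P.exists_eval_eq_mul_eval_cayley
  have hQ0 : Q = 0 := by
    refine Q.eq_zero_of_eval_exp_eq_zero ω hind fun t => ?_
    rw [hQ]
    by_cases hs : ∀ k, Real.sin (ω k * t / 2) ≠ 0
    · simp only [Complex.cayley_exp_eq_cot, h t hs, mul_zero]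
    · push Not at hs
      obtain ⟨k, hk⟩ := hs
      obtain ⟨m, hm⟩ := Real.sin_eq_zero_iff.mp hk
      have hexp : Complex.exp (Complex.I * (ω k * t)) = 1 := by
        refine Complex.exp_eq_one_iff.mpr ⟨m, ?_⟩
        have : (ω k * t : ℂ) = 2 * (m * Real.pi) := by
          have : ω k * t = 2 * (m * Real.pi) := by linarith
          exact_mod_cast this
        rw [this]
        ring
      rw [Finset.prod_eq_zero (Finset.mem_univ k) (by rw [hexp, sub_self]),
        zero_pow N.succ_ne_zero, zero_mul]
  refine funext_set (fun _ => {Complex.I}ᶜ) (fun _ => (Set.finite_singleton _).infinite_compl)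
    fun y hy => ?_
  have hy' : ∀ k, y k - Complex.I ≠ 0 := fun k => sub_ne_zero.mpr (hy k trivial)
  have hsub : ∀ k, (y k + Complex.I) / (y k - Complex.I) - 1 = 2 * Complex.I / (y k - Complex.I) :=
    fun k => by
      have := hy' k
      field_simp
      ring
  have hcayley : ∀ k, Complex.I * ((y k + Complex.I) / (y k - Complex.I) + 1) /
      ((y k + Complex.I) / (y k - Complex.I) - 1) = y k := fun k => by
    rw [hsub]
    have := hy' k
    have := Complex.I_ne_zero
    field_simp
    ring
  have hev := hQ fun k => (y k + Complex.I) / (y k - Complex.I)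
  simp only [hcayley] at hev
  simp only [hsub, hQ0, map_zero] at hev
  rw [map_zero]
  refine (mul_eq_zero.mp hev.symm).resolve_left (pow_ne_zero _ ?_)
  exact Finset.prod_ne_zero_iff.mpr fun k _ =>
    div_ne_zero (mul_ne_zero two_ne_zero Complex.I_ne_zero) (hy' k)

/-- Linear independence over `ℂ` of the cotangent monomials: if `ω₁, …, ωₙ > 0` are
linearly independent over `ℚ` and a finitely supported family of coefficients
`c : ℕⁿ → ℂ` satisfies `Σ_α c(α) Πₖ cot(ωₖt/2)^{αₖ} = 0` for all admissible `t`,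
then all coefficients vanish. -/
theorem stmt_7 (n : ℕ) (ω : Fin n → ℝ) (hω : ∀ k, 0 < ω k)
    (hind : ∀ q : Fin n → ℚ, (∑ k, (q k : ℝ) * ω k) = 0 → ∀ k, q k = 0)
    (c : (Fin n → ℕ) → ℂ) (hc : (Function.support c).Finite)
    (h : ∀ t : ℝ, (∀ k, Real.sin (ω k * t / 2) ≠ 0) →
      ∑ᶠ α : Fin n → ℕ, c α *
        ∏ k, ((Real.cos (ω k * t / 2) / Real.sin (ω k * t / 2) : ℝ) : ℂ) ^ (α k) = 0) :
    ∀ α : Fin n → ℕ, c α = 0 := by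
  classical
  let e : (Fin n → ℕ) ≃ (Fin n →₀ ℕ) := Finsupp.equivFunOnFinite.symm
  let P : MvPolynomial (Fin n) ℂ := ∑ α ∈ hc.toFinset, MvPolynomial.monomial (e α) (c α)
  have hP : P = 0 := by
    refine P.eq_zero_of_eval_cot_eq_zero ω hind fun t ht => ?_
    rw [← h t ht, finsum_eq_sum_of_support_subset (s := hc.toFinset), map_sum]
    · refine Finset.sum_congr rfl fun α _ => ?_
      rw [MvPolynomial.eval_monomial, Finsupp.prod_fintype _ _ fun _ => pow_zero _]
      rfl
    · intro α hα
      rw [hc.coe_toFinset]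
      exact left_ne_zero_of_mul hα
  intro α
  have hcoeff : P.coeff (e α) = c α := by
    simp only [P, MvPolynomial.coeff_sum, MvPolynomial.coeff_monomial, e.injective.eq_iff,
      Finset.sum_ite_eq', Set.Finite.mem_toFinset, Function.mem_support, ite_eq_left_iff, not_not]
    exact fun hα => hα.symm
  rw [← hcoeff, hP, MvPolynomial.coeff_zero]
end

section
/- Let n ≥ 1, ω₁, …, ωₙ > 0, δ > 0, τ ∈ (0,1), A > 0 and ρ > 1 − τ. Suppose E : ℕⁿ × (0,1] → ℝ satisfies |E(γ,ℏ) − ℏ·Σₖ ωₖ(γₖ + 1/2)| ≤ A·ℏ^{ρ} for all γ ∈ ℕⁿ and ℏ ∈ (0,1]. Then for every Schwartz function φ : ℝ → ℂ and every m ∈ ℕ there exist C > 0 and h₁ ∈ (0,1] such that for all ℏ ∈ (0,h₁], Σ_{γ ∈ ℕⁿ, E(γ,ℏ) > δℏ^{1−τ}} |φ(E(γ,ℏ)/ℏ)| ≤ C·ℏ^{m}. -/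
open scoped BigOperators

/-- A product of nonnegative summable families is summable over the product of the index types. -/
theorem summable_pi_prod_of_nonneg {ι κ : Type*} [Fintype ι] {f : ι → κ → ℝ}
    (hf₀ : ∀ i a, 0 ≤ f i a) (hf : ∀ i, Summable (f i)) :
    Summable fun γ : ι → κ => ∏ i, f i (γ i) := by
  classical
  refine summable_of_sum_le (c := ∏ i, ∑' a, f i a)
    (fun γ => Finset.prod_nonneg fun i _ => hf₀ i _) fun s => ?_
  calc ∑ γ ∈ s, ∏ i, f i (γ i)
      ≤ ∑ γ ∈ Fintype.piFinset fun i => s.image fun γ => γ i, ∏ i, f i (γ i) := by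
        refine Finset.sum_le_sum_of_subset_of_nonneg (fun γ hγ => ?_)
          fun γ _ _ => Finset.prod_nonneg fun i _ => hf₀ i _
        exact Fintype.mem_piFinset.2 fun i => Finset.mem_image_of_mem (fun γ => γ i) hγ
    _ = ∏ i, ∑ a ∈ s.image fun γ => γ i, f i a := (Finset.prod_univ_sum _ _).symm
    _ ≤ ∏ i, ∑' a, f i a :=
        Finset.prod_le_prod (fun i _ => Finset.sum_nonneg fun a _ => hf₀ i a)
          fun i _ => (hf i).sum_le_tsum _ fun a _ => hf₀ i a

/-- The shifted inverse squares `(ω (a + 1/2))⁻²` are summable over `a : ℕ`. -/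
theorem summable_inv_sq_mul_add_half (ω : ℝ) :
    Summable fun a : ℕ => ((ω * ((a : ℝ) + 1 / 2)) ^ 2)⁻¹ := by
  have h := (Real.summable_one_div_nat_add_rpow (1 / 2) 2).2 one_lt_two
  refine (h.mul_left ((ω ^ 2)⁻¹)).congr fun a => ?_
  rw [mul_pow, mul_inv, Real.rpow_two, sq_abs, one_div ((_ : ℝ) ^ 2)]

/-- The harmonic oscillator energies `∑ k, ω k * (γ k + 1/2)` have summable inverse
`2n`-th powers. -/
theorem summable_inv_pow_sum_mul_add_half {n : ℕ} {ω : Fin n → ℝ} (hω : ∀ k, 0 < ω k) :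
    Summable fun γ : Fin n → ℕ => ((∑ k, ω k * ((γ k : ℝ) + 1 / 2)) ^ (2 * n))⁻¹ := by
  have hpos : ∀ (γ : Fin n → ℕ) k, 0 < ω k * ((γ k : ℝ) + 1 / 2) := fun γ k =>
    mul_pos (hω k) (by positivity)
  refine Summable.of_nonneg_of_le (fun γ => ?_) (fun γ => ?_)
    (summable_pi_prod_of_nonneg (f := fun k (a : ℕ) => ((ω k * ((a : ℝ) + 1 / 2)) ^ 2)⁻¹)
      (fun k a => by positivity) fun k => summable_inv_sq_mul_add_half (ω k))
  · have := Finset.sum_nonneg fun k (_ : k ∈ Finset.univ) => (hpos γ k).le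
    positivity
  · rw [Finset.prod_inv_distrib]
    refine inv_anti₀ (Finset.prod_pos fun k _ => pow_pos (hpos γ k) 2) ?_
    calc ∏ k, (ω k * ((γ k : ℝ) + 1 / 2)) ^ 2
        ≤ ∏ _k : Fin n, (∑ k, ω k * ((γ k : ℝ) + 1 / 2)) ^ 2 :=
          Finset.prod_le_prod (fun k _ => sq_nonneg _) fun k _ =>
            pow_le_pow_left₀ (hpos γ k).le
              (Finset.single_le_sum (f := fun k => ω k * ((γ k : ℝ) + 1 / 2))
                (fun i _ => (hpos γ i).le) (Finset.mem_univ k)) 2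
      _ = (∑ k, ω k * ((γ k : ℝ) + 1 / 2)) ^ (2 * n) := by simp [pow_mul]

/-- An energy `e > δ ℏ^(1-τ)` lying within `A ℏ^ρ` of `ℏ S` satisfies `e / ℏ > δ ℏ^(-τ)` and
dominates `S` up to a constant factor, after rescaling. -/
theorem rescaled_energy_lower_bounds {δ τ A ρ ℏ e S : ℝ} (hδ : 0 < δ) (hA : 0 < A)
    (hρ : 1 - τ < ρ) (h₀ : 0 < ℏ) (h₁ : ℏ ≤ 1) (hS : |e - ℏ * S| ≤ A * ℏ ^ ρ)
    (he : δ * ℏ ^ (1 - τ) < e) :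
    δ * ℏ ^ (-τ) < e / ℏ ∧ S ≤ (1 + A / δ) * (e / ℏ) := by
  have hpow : ℏ ^ (1 - τ) = ℏ * ℏ ^ (-τ) := by
    rw [sub_eq_add_neg, Real.rpow_add h₀, Real.rpow_one]
  have hle : ℏ ^ ρ ≤ ℏ ^ (1 - τ) := Real.rpow_le_rpow_of_exponent_ge h₀ h₁ hρ.le
  refine ⟨?_, ?_⟩
  · rw [lt_div_iff₀ h₀]
    calc δ * ℏ ^ (-τ) * ℏ = δ * ℏ ^ (1 - τ) := by rw [hpow]; ring
      _ < e := he
  · rw [← mul_div_assoc, le_div_iff₀ h₀]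
    calc S * ℏ ≤ e + A * ℏ ^ ρ := by linarith [(abs_le.1 hS).1]
      _ ≤ e + A * ℏ ^ (1 - τ) := by gcongr
      _ = e + A / δ * (δ * ℏ ^ (1 - τ)) := by field_simp
      _ ≤ e + A / δ * e := by gcongr
      _ = (1 + A / δ) * e := by ring

/-- If `E(γ,ℏ)` is within `Aℏ^ρ` (with `ρ > 1 − τ`) of the harmonic oscillator
eigenvalue `ℏ Σₖ ωₖ(γₖ + 1/2)`, then for every Schwartz function `φ` and every `m`,
the sum of `|φ(E(γ,ℏ)/ℏ)|` over lattice points with `E(γ,ℏ) > δℏ^{1−τ}` is summable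
and bounded by `C ℏ^m` for small `ℏ`. -/
theorem stmt_10 (n : ℕ) (hn : 1 ≤ n) (ω : Fin n → ℝ) (hω : ∀ k, 0 < ω k)
    (δ τ A ρ : ℝ) (hδ : 0 < δ) (hτ : τ ∈ Set.Ioo (0 : ℝ) 1) (hA : 0 < A)
    (hρ : 1 - τ < ρ)
    (E : (Fin n → ℕ) → ℝ → ℝ)
    (hE : ∀ γ : Fin n → ℕ, ∀ ℏ ∈ Set.Ioc (0 : ℝ) 1,
      |E γ ℏ - ℏ * ∑ k, ω k * ((γ k : ℝ) + 1 / 2)| ≤ A * ℏ ^ ρ)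
    (φ : SchwartzMap ℝ ℂ) (m : ℕ) :
    ∃ C > 0, ∃ h₁ ∈ Set.Ioc (0 : ℝ) 1, ∀ ℏ ∈ Set.Ioc (0 : ℝ) h₁,
      Summable (fun γ : {γ : Fin n → ℕ // δ * ℏ ^ (1 - τ) < E γ ℏ} =>
        ‖φ (E γ.1 ℏ / ℏ)‖) ∧
      ∑' γ : {γ : Fin n → ℕ // δ * ℏ ^ (1 - τ) < E γ ℏ},
        ‖φ (E γ.1 ℏ / ℏ)‖ ≤ C * ℏ ^ (m : ℝ) := by
  have : Nonempty (Fin n) := ⟨⟨0, hn⟩⟩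
  obtain ⟨q, hq⟩ := exists_nat_ge ((m : ℝ) / τ)
  have hmq : (m : ℝ) ≤ τ * q := by
    rw [div_le_iff₀ hτ.1] at hq
    linarith
  obtain ⟨K, hK₀, hK⟩ := φ.decay (2 * n + q) 0
  set S : (Fin n → ℕ) → ℝ := fun γ => ∑ k, ω k * ((γ k : ℝ) + 1 / 2)
  have hS_pos : ∀ γ, 0 < S γ := fun γ =>
    Finset.sum_pos (fun k _ => mul_pos (hω k) (by positivity)) Finset.univ_nonempty
  have hS : Summable fun γ => (S γ ^ (2 * n))⁻¹ := summable_inv_pow_sum_mul_add_half hω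
  set B : ℝ := 1 + A / δ
  have hB : 0 < B := by positivity
  set D : ℝ := K * B ^ (2 * n) / δ ^ q with hD_def
  have hD : 0 < D := by positivity
  have hterm : ∀ ℏ ∈ Set.Ioc (0 : ℝ) 1, ∀ γ, δ * ℏ ^ (1 - τ) < E γ ℏ →
      ‖φ (E γ ℏ / ℏ)‖ ≤ D * ℏ ^ (m : ℝ) * (S γ ^ (2 * n))⁻¹ := by
    intro ℏ hℏ γ hγ
    obtain ⟨hx, hSx⟩ := rescaled_energy_lower_bounds hδ hA hρ hℏ.1 hℏ.2 (hE γ ℏ hℏ) hγ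
    set x := E γ ℏ / ℏ
    have hx₀ : 0 < δ * ℏ ^ (-τ) := mul_pos hδ (Real.rpow_pos_of_pos hℏ.1 _)
    have hx_pos : 0 < x := hx₀.trans hx
    have hdecay : x ^ (2 * n) * x ^ q * ‖φ x‖ ≤ K := by
      simpa [norm_iteratedFDeriv_zero, abs_of_pos hx_pos, pow_add] using hK x
    have hpow : (ℏ ^ (-τ)) ^ q * ℏ ^ (m : ℝ) ≥ 1 := by
      rw [← Real.rpow_mul_natCast hℏ.1.le, ← Real.rpow_add hℏ.1]
      exact Real.one_le_rpow_of_pos_of_le_one_of_nonpos hℏ.1 hℏ.2 (by linarith)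
    have hm : 0 < ℏ ^ (m : ℝ) := Real.rpow_pos_of_pos hℏ.1 _
    rw [← div_eq_mul_inv, le_div_iff₀ (pow_pos (hS_pos γ) _)]
    have hSpow : S γ ^ (2 * n) ≤ B ^ (2 * n) * x ^ (2 * n) := by
      rw [← mul_pow]
      exact pow_le_pow_left₀ (hS_pos γ).le hSx _
    have hxpow : δ ^ q ≤ x ^ q * ℏ ^ (m : ℝ) := by
      calc δ ^ q ≤ δ ^ q * ((ℏ ^ (-τ)) ^ q * ℏ ^ (m : ℝ)) :=
            le_mul_of_one_le_right (by positivity) hpow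
        _ = (δ * ℏ ^ (-τ)) ^ q * ℏ ^ (m : ℝ) := by rw [mul_pow]; ring
        _ ≤ x ^ q * ℏ ^ (m : ℝ) := by gcongr
    rw [hD_def, div_mul_eq_mul_div, le_div_iff₀ (by positivity)]
    calc ‖φ x‖ * S γ ^ (2 * n) * δ ^ q
        ≤ ‖φ x‖ * (B ^ (2 * n) * x ^ (2 * n)) * (x ^ q * ℏ ^ (m : ℝ)) := by gcongr
      _ = x ^ (2 * n) * x ^ q * ‖φ x‖ * (B ^ (2 * n) * ℏ ^ (m : ℝ)) := by ring
      _ ≤ K * (B ^ (2 * n) * ℏ ^ (m : ℝ)) := by gcongr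
      _ = K * B ^ (2 * n) * ℏ ^ (m : ℝ) := by ring
  have hS_inv : ∀ γ, 0 < (S γ ^ (2 * n))⁻¹ := fun γ => inv_pos.2 (pow_pos (hS_pos γ) _)
  refine ⟨D * ∑' γ, (S γ ^ (2 * n))⁻¹,
    mul_pos hD (hS.tsum_pos (fun γ => (hS_inv γ).le) 0 (hS_inv 0)), 1, ⟨one_pos, le_rfl⟩,
    fun ℏ hℏ => ?_⟩
  have hmaj : Summable fun γ => D * ℏ ^ (m : ℝ) * (S γ ^ (2 * n))⁻¹ := hS.mul_left _
  have hsub := hmaj.subtype {γ | δ * ℏ ^ (1 - τ) < E γ ℏ}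
  have hsum : Summable fun γ : {γ : Fin n → ℕ // δ * ℏ ^ (1 - τ) < E γ ℏ} =>
      ‖φ (E γ.1 ℏ / ℏ)‖ :=
    Summable.of_nonneg_of_le (fun _ => norm_nonneg _) (fun γ => hterm ℏ hℏ γ.1 γ.2) hsub
  have hm : 0 < ℏ ^ (m : ℝ) := Real.rpow_pos_of_pos hℏ.1 _
  refine ⟨hsum, ?_⟩
  calc _ ≤ ∑' γ : {γ | δ * ℏ ^ (1 - τ) < E γ ℏ}, D * ℏ ^ (m : ℝ) * (S γ.1 ^ (2 * n))⁻¹ :=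
        hsum.tsum_le_tsum (fun γ => hterm ℏ hℏ γ.1 γ.2) hsub
    _ ≤ ∑' γ, D * ℏ ^ (m : ℝ) * (S γ ^ (2 * n))⁻¹ :=
        hmaj.tsum_subtype_le _ _ fun γ => by have := hS_inv γ; positivity
    _ = D * (∑' γ, (S γ ^ (2 * n))⁻¹) * ℏ ^ (m : ℝ) := by rw [tsum_mul_left]; ring
end

section
/- Let ε ∈ (0, 1/6), let χ : ℝⁿ → ℝ be smooth with support contained in the closed unit ball, and let W : ℝⁿ → ℝ be smooth with W(0) = 0, DW(0) = 0 and D²W(0) = 0. For ℏ ∈ (0,1] define W*_ℏ(x) = χ(ℏ^{ε}x) · W(ℏ^{1/2}x) · ℏ^{−3(1/2−ε)}. Then for every m ∈ ℕ there is a constant C_m such that for all ℏ ∈ (0,1] and all x ∈ ℝⁿ, the m-th iterated derivative of W*_ℏ at x has norm at most C_m. -/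
open scoped BigOperators

section

variable {E : Type*} [NormedAddCommGroup E] [NormedSpace ℝ E]

/-- A smooth function has iterated derivatives bounded on the closed unit ball. -/
theorem exists_norm_iteratedFDeriv_le_closedBall [ProperSpace E] {f : E → ℝ}
    (hf : ContDiff ℝ (⊤ : ℕ∞) f) (j : ℕ) :
    ∃ C : ℝ, 0 ≤ C ∧ ∀ y ∈ Metric.closedBall (0 : E) 1, ‖iteratedFDeriv ℝ j f y‖ ≤ C := by
  obtain ⟨C, hC⟩ := (isCompact_closedBall (0 : E) 1).exists_bound_of_continuousOn
    (hf.continuous_iteratedFDeriv (m := j) (mod_cast le_top)).continuousOn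
  exact ⟨C, (norm_nonneg _).trans (hC 0 (by simp)), hC⟩

/-- If the derivatives of order `j, …, j + d - 1` of a smooth function vanish at the origin, then
its `j`-th derivative is `O(‖y‖ ^ d)` on the closed unit ball. -/
theorem exists_norm_iteratedFDeriv_le_mul_norm_pow [ProperSpace E] {f : E → ℝ}
    (hf : ContDiff ℝ (⊤ : ℕ∞) f) (d j : ℕ)
    (h0 : ∀ i, j ≤ i → i < j + d → iteratedFDeriv ℝ i f 0 = 0) :
    ∃ C : ℝ, 0 ≤ C ∧
      ∀ y ∈ Metric.closedBall (0 : E) 1, ‖iteratedFDeriv ℝ j f y‖ ≤ C * ‖y‖ ^ d := by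
  induction d generalizing j with
  | zero => simpa using exists_norm_iteratedFDeriv_le_closedBall hf j
  | succ d ih =>
    obtain ⟨C, hC0, hC⟩ := ih (j + 1) fun i hi hi' => h0 i (by lia) (by lia)
    refine ⟨C, hC0, fun y hy => ?_⟩
    have hy1 : ‖y‖ ≤ 1 := by simpa using hy
    have key := (convex_closedBall (0 : E) ‖y‖).norm_image_sub_le_of_norm_fderiv_le
      (𝕜 := ℝ) (f := iteratedFDeriv ℝ j f) (C := C * ‖y‖ ^ d) (x := 0) (y := y)
      (fun z _ => (hf.differentiable_iteratedFDeriv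
        (m := j) (mod_cast WithTop.coe_lt_top j)).differentiableAt)
      (fun z hz => by
        have hz : ‖z‖ ≤ ‖y‖ := by simpa using hz
        rw [norm_fderiv_iteratedFDeriv]
        refine (hC z (by simpa using hz.trans hy1)).trans ?_
        gcongr)
      (by simp) (by simp)
    rw [h0 j le_rfl (by lia), sub_zero, sub_zero] at key
    rwa [pow_succ, ← mul_assoc]

/-- If `χ` is smooth and supported in the closed unit ball and `W` is smooth and vanishes to order
`k` at the origin, then the functions `z ↦ χ z * W (r • z)`, `r ∈ [0, 1]`, have `m`-th derivative
`O(r ^ k)`. -/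
theorem exists_norm_iteratedFDeriv_mul_comp_smul_le [ProperSpace E] {χ W : E → ℝ}
    (hχ : ContDiff ℝ (⊤ : ℕ∞) χ) (hχsupp : Function.support χ ⊆ Metric.closedBall 0 1)
    (hW : ContDiff ℝ (⊤ : ℕ∞) W) (k : ℕ) (h0 : ∀ i < k, iteratedFDeriv ℝ i W 0 = 0) (m : ℕ) :
    ∃ C : ℝ, ∀ r ∈ Set.Icc (0 : ℝ) 1, ∀ z : E,
      ‖iteratedFDeriv ℝ m (fun y => χ y * W (r • y)) z‖ ≤ C * r ^ k := by
  choose A hA0 hA using exists_norm_iteratedFDeriv_le_closedBall hχ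
  choose B hB0 hB using fun j => exists_norm_iteratedFDeriv_le_mul_norm_pow hW (k - j) j
    fun i hi hi' => h0 i (by lia)
  refine ⟨∑ i ∈ Finset.range (m + 1), (m.choose i : ℝ) * A i * B (m - i), fun r hr z => ?_⟩
  obtain ⟨hr0, hr1⟩ := hr
  have hWr : ContDiff ℝ (⊤ : ℕ∞) fun y => W (r • y) := hW.comp (contDiff_const_smul r)
  refine (norm_iteratedFDeriv_mul_le hχ hWr z (n := m) (mod_cast le_top)).trans ?_
  rw [Finset.sum_mul]
  refine Finset.sum_le_sum fun i _ => ?_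
  generalize m - i = j
  by_cases hz : z ∈ Metric.closedBall (0 : E) 1
  · have hz1 : ‖z‖ ≤ 1 := by simpa using hz
    have hrz : ‖r • z‖ ≤ r := by
      rw [norm_smul, Real.norm_of_nonneg hr0]
      exact mul_le_of_le_one_right hr0 hz1
    have hWj : ‖iteratedFDeriv ℝ j (fun y => W (r • y)) z‖ ≤ B j * r ^ k := by
      rw [iteratedFDeriv_comp_const_smul r (hW.of_le (mod_cast le_top)), norm_smul, norm_pow,
        Real.norm_of_nonneg hr0]
      calc r ^ j * ‖iteratedFDeriv ℝ j W (r • z)‖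
          ≤ r ^ j * (B j * r ^ (k - j)) := by
            gcongr
            refine (hB j (r • z) (by simpa using hrz.trans hr1)).trans ?_
            have := hB0 j
            gcongr
        _ = B j * r ^ (j + (k - j)) := by ring
        _ ≤ B j * r ^ k :=
            mul_le_mul_of_nonneg_left (pow_le_pow_of_le_one hr0 hr1 (by lia)) (hB0 _)
    rw [mul_assoc _ (B j)]
    have := hA0 i
    gcongr
    exact hA i z hz
  · have hsupp : z ∉ Function.support (iteratedFDeriv ℝ i χ) := fun h =>
      hz (closure_minimal hχsupp Metric.isClosed_closedBall
        (support_iteratedFDeriv_subset i h))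
    rw [Function.notMem_support.mp hsupp, norm_zero, mul_zero, zero_mul]
    have := hA0 i
    have := hB0 j
    positivity

end

/-- The rescaled cut-off perturbation `W*_ℏ(x) = χ(ℏ^ε x) W(ℏ^{1/2} x) ℏ^{−3(1/2−ε)}`
is bounded with bounded derivatives, uniformly in `ℏ ∈ (0,1]`, when `χ` is smooth with
support in the closed unit ball and `W` is smooth and vanishes to order 3 at the
origin. -/
theorem stmt_11 (n : ℕ) (ε : ℝ) (hε : ε ∈ Set.Ioo (0 : ℝ) (1 / 6 : ℝ))
    (χ : EuclideanSpace ℝ (Fin n) → ℝ) (hχ : ContDiff ℝ (⊤ : ℕ∞) χ)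
    (hχsupp : Function.support χ ⊆ Metric.closedBall 0 1)
    (W : EuclideanSpace ℝ (Fin n) → ℝ) (hW : ContDiff ℝ (⊤ : ℕ∞) W)
    (hW0 : W 0 = 0) (hW1 : fderiv ℝ W 0 = 0) (hW2 : iteratedFDeriv ℝ 2 W 0 = 0) :
    ∀ m : ℕ, ∃ C : ℝ, ∀ ℏ ∈ Set.Ioc (0 : ℝ) 1, ∀ x : EuclideanSpace ℝ (Fin n),
      ‖iteratedFDeriv ℝ m
          (fun y : EuclideanSpace ℝ (Fin n) =>
            χ (ℏ ^ ε • y) * W (ℏ ^ (1 / 2 : ℝ) • y) * ℏ ^ (-(3 * (1 / 2 - ε)))) x‖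
        ≤ C := by
  intro m
  obtain ⟨hε0, hε1⟩ := hε
  have h0 : ∀ i < 3, iteratedFDeriv ℝ i W 0 = 0 := by
    intro i hi
    interval_cases i
    · rw [← norm_eq_zero, norm_iteratedFDeriv_zero, hW0, norm_zero]
    · rw [← norm_eq_zero, norm_iteratedFDeriv_one, hW1, norm_zero]
    · exact hW2
  obtain ⟨C, hC⟩ := exists_norm_iteratedFDeriv_mul_comp_smul_le hχ hχsupp hW 3 h0 m
  refine ⟨C, fun ℏ hℏ x => ?_⟩
  obtain ⟨hℏ0, hℏ1⟩ := hℏ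
  set r : ℝ := ℏ ^ (1 / 2 - ε) with hr
  have hr0 : 0 < r := Real.rpow_pos_of_pos hℏ0 _
  have hr1 : r ≤ 1 := Real.rpow_le_one hℏ0.le hℏ1 (by linarith)
  have hδ0 : 0 ≤ ℏ ^ ε := Real.rpow_nonneg hℏ0.le _
  have hδ1 : ℏ ^ ε ≤ 1 := Real.rpow_le_one hℏ0.le hℏ1 hε0.le
  have hs : ℏ ^ (1 / 2 : ℝ) = r * ℏ ^ ε := by
    rw [hr, ← Real.rpow_add hℏ0, sub_add_cancel]
  have hc : ℏ ^ (-(3 * (1 / 2 - ε))) = (r ^ 3)⁻¹ := by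
    rw [Real.rpow_neg hℏ0.le, mul_comm, Real.rpow_mul hℏ0.le]
    norm_cast
  have hG : ContDiff ℝ (⊤ : ℕ∞) fun y => χ y * W (r • y) :=
    hχ.mul (hW.comp (contDiff_const_smul r))
  have hGδ : ContDiff ℝ (⊤ : ℕ∞) fun y => χ (ℏ ^ ε • y) * W (r • ℏ ^ ε • y) :=
    hG.comp (contDiff_const_smul (ℏ ^ ε))
  have hfun : (fun y => χ (ℏ ^ ε • y) * W (ℏ ^ (1 / 2 : ℝ) • y) * ℏ ^ (-(3 * (1 / 2 - ε)))) =
      fun y => (r ^ 3)⁻¹ • (χ (ℏ ^ ε • y) * W (r • ℏ ^ ε • y)) := by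
    funext y
    rw [hs, hc, mul_smul, smul_eq_mul, mul_comm]
  rw [hfun, iteratedFDeriv_const_smul_apply' (hGδ.of_le (mod_cast le_top)).contDiffAt,
    iteratedFDeriv_comp_const_smul (ℏ ^ ε) (f := fun y => χ y * W (r • y))
      (hG.of_le (mod_cast le_top)), norm_smul, norm_smul, norm_pow,
    Real.norm_of_nonneg hδ0, Real.norm_of_nonneg (by positivity), inv_mul_le_iff₀ (by positivity),
    mul_comm (r ^ 3)]
  exact (mul_le_of_le_one_left (norm_nonneg _) (pow_le_one₀ hδ0 hδ1)).trans
    (hC r ⟨hr0.le, hr1⟩ _)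
end

section
/- Fix n ≥ 1, l ≥ 1, ω₁,…,ωₙ > 0 and t ∈ ℝ with cos(ωₖt/2) ≠ 0 and sin(ωₖt) ≠ 0 for all k. Let H_l be the (2l+1)n × (2l+1)n real matrix written in block form with respect to the decomposition ℝⁿ ⊕ ℝ^{ln} ⊕ ℝ^{ln} as H_l = [[K,0,0],[0,A,B],[0,Bᵀ,0]], where: K = diag(−2ω₁tan(ω₁t/2), …, −2ωₙtan(ωₙt/2)); A is the ln×ln matrix whose (1,1) n×n block is diag(ω₁cot(ω₁t), …, ωₙcot(ωₙt)) and whose other blocks are zero; and B is the ln×ln matrix of n×n blocks with −I on the block diagonal, I on the block subdiagonal, and 0 elsewhere. Then det H_l = (−1)^{(l+1)n} · Πₖ 2ωₖ tan(ωₖt/2). -/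
open Matrix
open scoped BigOperators

/-- The determinant of the block matrix that swaps two copies of a space. -/
theorem det_fromBlocks_zero_one_one_zero {m R : Type*} [Fintype m] [DecidableEq m] [CommRing R] :
    (fromBlocks 0 1 1 0 : Matrix (m ⊕ m) (m ⊕ m) R).det = (-1) ^ Fintype.card m := by
  have h : (fromBlocks 0 1 1 0 * fromBlocks 1 0 1 1 : Matrix (m ⊕ m) (m ⊕ m) R) =
        fromBlocks 1 1 1 0 := by
    simp [fromBlocks_multiply]
  have h' := congrArg det h
  rw [det_mul, det_fromBlocks_zero₁₂, det_fromBlocks_one₁₁] at h'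
  simpa [det_neg] using h'

/-- The determinant of a block matrix whose lower right block vanishes. -/
theorem det_fromBlocks_zero_lower_right {m R : Type*} [Fintype m] [DecidableEq m] [CommRing R]
    (A B C : Matrix m m R) :
    (fromBlocks A B C 0).det = (-1) ^ Fintype.card m * (B.det * C.det) := by
  have h : fromBlocks B A 0 C * fromBlocks 0 1 1 0 = fromBlocks A B C 0 := by
    simp [fromBlocks_multiply]
  rw [← h, det_mul, det_fromBlocks_zero₂₁, det_fromBlocks_zero_one_one_zero, mul_comm]

/-- A block upper triangular matrix whose diagonal blocks are all `-1` has determinant `±1`. -/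
theorem det_mul_self_of_blockTriangular_neg_one {m α R : Type*} [Fintype m] [DecidableEq m]
    [Fintype α] [LinearOrder α] [CommRing R] {M : Matrix m m R} {b : m → α}
    (hM : M.BlockTriangular b) (hdiag : ∀ a, M.toSquareBlock b a = -1) :
    M.det * M.det = 1 := by
  rw [hM.det_fintype, ← Finset.prod_mul_distrib]
  refine Finset.prod_eq_one fun a _ => ?_
  rw [hdiag, ← det_mul]
  simp

/-- The determinant of the Hessian `H_l` of the phase `Ψ_l`:
`H_l = [[K,0,0],[0,A,B],[0,Bᵀ,0]]` in block form on `ℝⁿ ⊕ ℝ^{ln} ⊕ ℝ^{ln}`, with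
`K = diag(−2ωₖ tan(ωₖt/2))`, `A` having `Ω = diag(ωₖ cot(ωₖt))` as its `(1,1)` block
and zeros elsewhere, `B` having `−I` on the block diagonal and `I` on the block
subdiagonal.  Then `det H_l = (−1)^{(l+1)n} Πₖ 2ωₖ tan(ωₖt/2)`. -/
theorem stmt_15 (n l : ℕ) (hn : 1 ≤ n) (hl : 1 ≤ l)
    (ω : Fin n → ℝ) (hω : ∀ k, 0 < ω k) (t : ℝ)
    (hcos : ∀ k, Real.cos (ω k * t / 2) ≠ 0)
    (hsin : ∀ k, Real.sin (ω k * t) ≠ 0)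
    (K : Matrix (Fin n) (Fin n) ℝ)
    (hK : K = Matrix.diagonal (fun k => -2 * ω k * Real.tan (ω k * t / 2)))
    (A : Matrix (Fin l × Fin n) (Fin l × Fin n) ℝ)
    (hA : ∀ p q : Fin l × Fin n, A p q =
      if (p.1 : ℕ) = 0 ∧ (q.1 : ℕ) = 0 ∧ p.2 = q.2 then
        ω p.2 * (Real.cos (ω p.2 * t) / Real.sin (ω p.2 * t)) else 0)
    (B : Matrix (Fin l × Fin n) (Fin l × Fin n) ℝ)
    (hB : ∀ p q : Fin l × Fin n, B p q =
      if p.1 = q.1 ∧ p.2 = q.2 then -1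
      else if (p.1 : ℕ) = (q.1 : ℕ) + 1 ∧ p.2 = q.2 then 1 else 0) :
    (Matrix.fromBlocks K 0 0 (Matrix.fromBlocks A B Bᵀ 0)).det
      = (-1) ^ ((l + 1) * n) * ∏ k, 2 * ω k * Real.tan (ω k * t / 2) := by
  have hBB : B.det * B.det = 1 := by
    rw [← det_transpose B]
    refine det_mul_self_of_blockTriangular_neg_one (b := Prod.fst) ?_ ?_
    · intro p q hpq
      have hlt : (q.1 : ℕ) < p.1 := hpq
      rw [transpose_apply, hB, if_neg (fun h => hpq.ne h.1), if_neg (by omega)]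
    · intro a
      ext ⟨⟨i, k⟩, hi⟩ ⟨⟨j, k'⟩, hj⟩
      obtain rfl : i = a := hi
      obtain rfl : j = i := hj
      by_cases h : k = k' <;> simp [toSquareBlock_def, hB, one_apply, h, eq_comm (a := k')]
  have hKdet : K.det = (-1) ^ n * ∏ k, 2 * ω k * Real.tan (ω k * t / 2) := by
    have h := Finset.prod_neg (s := Finset.univ) (f := fun k => 2 * ω k * Real.tan (ω k * t / 2))
    simp only [Finset.card_univ, Fintype.card_fin] at h
    rw [hK, det_diagonal, ← h]
    exact Finset.prod_congr rfl fun k _ => by ring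
  rw [det_fromBlocks_zero₂₁, det_fromBlocks_zero_lower_right, det_transpose, hBB, hKdet]
  simp only [Fintype.card_prod, Fintype.card_fin]
  ring
end

section
/- Fix n ≥ 1, l ≥ 1, ω₁,…,ωₙ > 0 and t ∈ ℝ with cos(ωₖt/2) ≠ 0, sin(ωₖt) ≠ 0 and sin(ωₖt/2) ≠ 0 for all k. Let H_l = [[K,0,0],[0,A,B],[0,Bᵀ,0]] be the (2l+1)n × (2l+1)n block matrix with K = diag(−2ωₖtan(ωₖt/2)), A the ln×ln matrix whose (1,1) n×n block is Ω = diag(ωₖcot(ωₖt)) and whose other blocks vanish, and B the ln×ln block matrix with −I on the block diagonal and I on the block subdiagonal. Then H_l is invertible, and H_l⁻¹ = [[K⁻¹,0,0],[0,0,U],[0,L,−Ω̃]], where K⁻¹ = diag(−cot(ωₖt/2)/(2ωₖ)), U is the ln×ln block matrix with −I in every block on or above the block diagonal and 0 below, L is the ln×ln block matrix with −I in every block on or below the block diagonal and 0 above, and Ω̃ is the ln×ln matrix all of whose n×n blocks equal Ω = diag(ωₖcot(ωₖt)). -/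
open Matrix
open scoped BigOperators

/-- Left multiplication by the block matrix with `-1` on the diagonal and `1` on the block
subdiagonal takes backward differences of block rows, up to sign. -/
lemma sum_blockDifference_mul {n l : ℕ} {B : Matrix (Fin l × Fin n) (Fin l × Fin n) ℝ}
    (hB : ∀ p q : Fin l × Fin n, B p q =
      if p.1 = q.1 ∧ p.2 = q.2 then -1
      else if (p.1 : ℕ) = (q.1 : ℕ) + 1 ∧ p.2 = q.2 then 1 else 0)
    (f : Fin l × Fin n → ℝ) (p : Fin l × Fin n) :
    ∑ q, B p q * f q =
      -f p + if 0 < (p.1 : ℕ) then f (⟨p.1 - 1, by omega⟩, p.2) else 0 := by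
  have hterm : ∀ q, B p q * f q = (if p = q then -f q else 0) +
      if 0 < (p.1 : ℕ) then
        (if ((⟨p.1 - 1, by omega⟩, p.2) : Fin l × Fin n) = q then f q else 0) else 0 := by
    rintro ⟨j, b⟩
    obtain ⟨i, a⟩ := p
    rw [hB]
    simp only [Prod.mk.injEq, Fin.ext_iff]
    split_ifs <;> first | omega | simp
  rw [Finset.sum_congr rfl fun q _ => hterm q, Finset.sum_add_distrib]
  by_cases h : 0 < (p.1 : ℕ) <;> simp [h]

/-- The inverse of the Hessian `H_l = [[K,0,0],[0,A,B],[0,Bᵀ,0]]` of the phase `Ψ_l`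
is `[[K⁻¹,0,0],[0,0,U],[0,L,−Ω̃]]`, where `K⁻¹ = diag(−cot(ωₖt/2)/(2ωₖ))`, `U` has
`−I` in every block on or above the block diagonal, `L` has `−I` in every block on or
below the block diagonal, and every `n×n` block of `Ω̃` equals `Ω = diag(ωₖ cot(ωₖt))`. -/
theorem stmt_16 (n l : ℕ) (hn : 1 ≤ n) (hl : 1 ≤ l)
    (ω : Fin n → ℝ) (hω : ∀ k, 0 < ω k) (t : ℝ)
    (hcos : ∀ k, Real.cos (ω k * t / 2) ≠ 0)
    (hsin : ∀ k, Real.sin (ω k * t) ≠ 0)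
    (hsin2 : ∀ k, Real.sin (ω k * t / 2) ≠ 0)
    (K : Matrix (Fin n) (Fin n) ℝ)
    (hK : K = Matrix.diagonal (fun k => -2 * ω k * Real.tan (ω k * t / 2)))
    (A : Matrix (Fin l × Fin n) (Fin l × Fin n) ℝ)
    (hA : ∀ p q : Fin l × Fin n, A p q =
      if (p.1 : ℕ) = 0 ∧ (q.1 : ℕ) = 0 ∧ p.2 = q.2 then
        ω p.2 * (Real.cos (ω p.2 * t) / Real.sin (ω p.2 * t)) else 0)
    (B : Matrix (Fin l × Fin n) (Fin l × Fin n) ℝ)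
    (hB : ∀ p q : Fin l × Fin n, B p q =
      if p.1 = q.1 ∧ p.2 = q.2 then -1
      else if (p.1 : ℕ) = (q.1 : ℕ) + 1 ∧ p.2 = q.2 then 1 else 0)
    (U : Matrix (Fin l × Fin n) (Fin l × Fin n) ℝ)
    (hU : ∀ p q : Fin l × Fin n, U p q =
      if p.1 ≤ q.1 ∧ p.2 = q.2 then -1 else 0)
    (L : Matrix (Fin l × Fin n) (Fin l × Fin n) ℝ)
    (hL : ∀ p q : Fin l × Fin n, L p q =
      if q.1 ≤ p.1 ∧ p.2 = q.2 then -1 else 0)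
    (Ω' : Matrix (Fin l × Fin n) (Fin l × Fin n) ℝ)
    (hΩ' : ∀ p q : Fin l × Fin n, Ω' p q =
      if p.2 = q.2 then ω p.2 * (Real.cos (ω p.2 * t) / Real.sin (ω p.2 * t)) else 0) :
    IsUnit (Matrix.fromBlocks K 0 0 (Matrix.fromBlocks A B Bᵀ 0)) ∧
    (Matrix.fromBlocks K 0 0 (Matrix.fromBlocks A B Bᵀ 0))⁻¹
      = Matrix.fromBlocks
          (Matrix.diagonal (fun k =>
            -(Real.cos (ω k * t / 2) / Real.sin (ω k * t / 2)) / (2 * ω k))) 0 0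
          (Matrix.fromBlocks 0 U L (-Ω')) := by
  have hBL : B * L = 1 := by
    ext ⟨i, a⟩ ⟨j, b⟩
    rw [Matrix.mul_apply, sum_blockDifference_mul hB]
    simp only [hL, Matrix.one_apply, Prod.mk.injEq, Fin.ext_iff, Fin.le_def]
    split_ifs <;> first | omega | norm_num
  have hUL : U = Lᵀ := by
    ext p q
    simp only [hU, hL, Matrix.transpose_apply, eq_comm]
  have hBU : Bᵀ * U = 1 := by
    rw [hUL, ← Matrix.transpose_mul, mul_eq_one_comm.mp hBL, Matrix.transpose_one]
  have hAU : A * U = B * Ω' := by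
    ext ⟨i, a⟩ ⟨j, b⟩
    rw [Matrix.mul_apply, Matrix.mul_apply, sum_blockDifference_mul hB,
      Finset.sum_eq_single (⟨0, hl⟩, a)]
    · simp only [hA, hU, hΩ', Fin.le_def]
      by_cases hi : (i : ℕ) = 0 <;> by_cases hab : a = b <;> simp [hi, hab, Nat.pos_iff_ne_zero]
    · rintro ⟨k, c⟩ - hk
      have hk' : ¬ ((i : ℕ) = 0 ∧ (k : ℕ) = 0 ∧ a = c) := by
        rintro ⟨-, h0, rfl⟩
        exact hk (by simp [Fin.ext_iff, h0])
      simp only [hA, if_neg hk', zero_mul]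
    · simp
  have hKinv : K * Matrix.diagonal (fun k =>
      -(Real.cos (ω k * t / 2) / Real.sin (ω k * t / 2)) / (2 * ω k)) = 1 := by
    rw [hK, Matrix.diagonal_mul_diagonal, ← Matrix.diagonal_one]
    congr 1
    funext k
    have := hcos k
    have := hsin2 k
    have := (hω k).ne'
    rw [Real.tan_eq_sin_div_cos]
    field_simp
  have hmul : Matrix.fromBlocks K 0 0 (Matrix.fromBlocks A B Bᵀ 0) *
      Matrix.fromBlocks (Matrix.diagonal (fun k =>
        -(Real.cos (ω k * t / 2) / Real.sin (ω k * t / 2)) / (2 * ω k))) 0 0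
        (Matrix.fromBlocks 0 U L (-Ω')) = 1 := by
    simp [Matrix.fromBlocks_multiply, hKinv, hBL, hBU, hAU]
  exact ⟨IsUnit.of_mul_eq_one _ hmul, Matrix.inv_eq_right_inv hmul⟩
end

section
/- Fix n ≥ 1, ω₁,…,ωₙ > 0 and t, s ∈ ℝ with sin(ωₖt) ≠ 0 for all k. Index ℝ^{3n} by coordinates (x¹,…,xⁿ, z¹,…,zⁿ, ξ¹,…,ξⁿ) and let h be the symmetric 3n×3n real matrix whose only nonzero entries are h_{xᵏxᵏ} = −cot(ωₖt/2)/(2ωₖ), h_{zᵏξᵏ} = h_{ξᵏzᵏ} = −1 and h_{ξᵏξᵏ} = −ωₖcot(ωₖt), for k = 1,…,n. Let L : ℝ^{3n} → ℝⁿ be the linear map whose k-th component is (cos(ωₖs)/2)·zᵏ − (sin(ωₖs)/ωₖ)·ξᵏ + ((sin(ωₖ(t−s)) + sin(ωₖs))/sin(ωₖt))·xᵏ. Then for every smooth function W : ℝⁿ → ℝ, every integer j ≥ 0 and every point p ∈ ℝ^{3n}: (Σ_{r,r'} h_{rr'} ∂_r ∂_{r'})^{j+1} (W∘L)(p) = (j+1)!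 · Σ_{α ∈ ℕⁿ, |α| = j+1} (1/α!) · Πₖ (−cot(ωₖt/2)/(2ωₖ))^{αₖ} · (∂^{2α}W)(L(p)), where the sum on the left is over all pairs of coordinates r, r' of ℝ^{3n} and the operator is iterated j+1 times. -/
open scoped BigOperators

/-- Directional (partial) derivative of a function of finitely many real coordinates
along the `r`-th coordinate axis. -/
noncomputable def Dcoord {ι : Type*} [Fintype ι] [DecidableEq ι] (r : ι)
    (f : (ι → ℝ) → ℝ) : (ι → ℝ) → ℝ :=
  fun y => fderiv ℝ f y (Pi.single r 1)

/-- Mixed partial derivative `∂^α` associated to a multi-index `α ∈ ℕⁿ`: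
the `k`-th coordinate derivative is applied `α k` times, for each `k`. -/
noncomputable def mpart (n : ℕ) (α : Fin n → ℕ)
    (f : (Fin n → ℝ) → ℝ) : (Fin n → ℝ) → ℝ :=
  (List.finRange n).foldr (fun k g => (Dcoord k)^[α k] g) f

/-- The second-order operator `Σ_{r,r'} h_{rr'} ∂_r ∂_{r'}` associated to a symmetric
matrix of coefficients `h`. -/
noncomputable def OpH {ι : Type*} [Fintype ι] [DecidableEq ι] (h : ι → ι → ℝ)
    (f : (ι → ℝ) → ℝ) : (ι → ℝ) → ℝ :=
  fun y => ∑ r, ∑ r', h r r' * Dcoord r (Dcoord r' f) y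

/-- The space of smooth real functions of finitely many real coordinates. -/
def smoothFun (ι : Type*) [Fintype ι] : Submodule ℝ ((ι → ℝ) → ℝ) where
  carrier := {f | ContDiff ℝ (⊤ : ℕ∞) f}
  add_mem' := by
    intro f g hf hg
    rw [Set.mem_ofPred_eq] at *
    exact hf.add hg
  zero_mem' := Set.mem_ofPred_eq ▸ contDiff_const
  smul_mem' := by
    intro c f hf
    rw [Set.mem_ofPred_eq] at *
    exact hf.const_smul c

lemma mem_smoothFun {ι : Type*} [Fintype ι] {f : (ι → ℝ) → ℝ} :
    f ∈ smoothFun ι ↔ ContDiff ℝ (⊤ : ℕ∞) f :=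
  Iff.of_eq Set.mem_ofPred_eq

lemma smoothFun_contDiff {ι : Type*} [Fintype ι] (f : smoothFun ι) :
    ContDiff ℝ (⊤ : ℕ∞) (f : (ι → ℝ) → ℝ) :=
  mem_smoothFun.1 f.2

lemma smoothFun_differentiable {ι : Type*} [Fintype ι] (f : smoothFun ι) :
    Differentiable ℝ (f : (ι → ℝ) → ℝ) :=
  (smoothFun_contDiff f).differentiable (by simp)

section

variable {ι κ : Type*} [Fintype ι] [DecidableEq ι] [Fintype κ] [DecidableEq κ]

lemma contDiff_Dcoord (r : ι) {f : (ι → ℝ) → ℝ} (hf : ContDiff ℝ (⊤ : ℕ∞) f) :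
    ContDiff ℝ (⊤ : ℕ∞) (Dcoord r f) :=
  (hf.fderiv_right (m := (⊤ : ℕ∞)) (by simp)).clm_apply contDiff_const

/-- The coordinate derivative as a linear endomorphism of the smooth functions. -/
noncomputable def dcoordEnd (r : ι) : Module.End ℝ (smoothFun ι) where
  toFun f := ⟨Dcoord r f, mem_smoothFun.2 (contDiff_Dcoord r (smoothFun_contDiff f))⟩
  map_add' f g := by
    ext y
    simp [Dcoord, fderiv_add (smoothFun_differentiable f y) (smoothFun_differentiable g y)]
  map_smul' c f := by
    ext y
    simp [Dcoord, fderiv_const_smul (smoothFun_differentiable f y)]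

lemma coe_dcoordEnd (r : ι) (f : smoothFun ι) :
    (dcoordEnd r f : (ι → ℝ) → ℝ) = Dcoord r f := rfl

lemma coe_dcoordEnd_pow (r : ι) (m : ℕ) (f : smoothFun ι) :
    ((dcoordEnd r ^ m) f : (ι → ℝ) → ℝ) = (Dcoord r)^[m] f := by
  induction m with
  | zero => rfl
  | succ m ih => rw [pow_succ', Module.End.mul_apply, coe_dcoordEnd, ih,
      Function.iterate_succ_apply']

lemma dcoordEnd_commute (r r' : ι) : Commute (dcoordEnd r) (dcoordEnd r') := by
  refine LinearMap.ext fun f => Subtype.ext (funext fun y => ?_)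
  have hd : DifferentiableAt ℝ (fderiv ℝ (f : (ι → ℝ) → ℝ)) y :=
    ((smoothFun_contDiff f).fderiv_right (m := (⊤ : ℕ∞)) (by simp)).differentiable (by simp) y
  have key : ∀ a b : ι, Dcoord a (Dcoord b f) y =
      fderiv ℝ (fderiv ℝ (f : (ι → ℝ) → ℝ)) y (Pi.single a 1) (Pi.single b 1) := by
    intro a b
    unfold Dcoord
    rw [fderiv_clm_apply hd (differentiableAt_const _)]
    simp
  have hsymm : IsSymmSndFDerivAt ℝ (f : (ι → ℝ) → ℝ) y :=
    (smoothFun_contDiff f).contDiffAt.isSymmSndFDerivAt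
      (by simpa using WithTop.coe_le_coe.2 (le_top : (2 : ℕ∞) ≤ ⊤))
  change Dcoord r (Dcoord r' f) y = Dcoord r' (Dcoord r f) y
  rw [key, key, hsymm.eq]

lemma Dcoord_const_mul_comp (L : (ι → ℝ) →L[ℝ] (κ → ℝ)) {r : ι} {k : κ} {a : ℝ}
    (hr : L (Pi.single r 1) = a • Pi.single k 1) (c : ℝ) (f : smoothFun κ) :
    Dcoord r (fun y => c * (f : (κ → ℝ) → ℝ) (L y)) = fun y => (c * a) * Dcoord k f (L y) := by
  funext y
  have hf := (smoothFun_differentiable f (L y)).hasFDerivAt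
  have := (hf.comp y L.hasFDerivAt).const_mul c
  unfold Dcoord
  rw [HasFDerivAt.fderiv (f := fun y => c * (f : (κ → ℝ) → ℝ) (L y)) this]
  simp [hr, mul_assoc]

lemma Dcoord_Dcoord_comp (L : (ι → ℝ) →L[ℝ] (κ → ℝ)) {r r' : ι} {k k' : κ} {a a' : ℝ}
    (hr : L (Pi.single r 1) = a • Pi.single k 1)
    (hr' : L (Pi.single r' 1) = a' • Pi.single k' 1) (f : smoothFun κ) (y : ι → ℝ) :
    Dcoord r (Dcoord r' (fun y => (f : (κ → ℝ) → ℝ) (L y))) y =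
      (a' * a) * Dcoord k (Dcoord k' f) (L y) := by
  have h1 := Dcoord_const_mul_comp L hr' 1 f
  simp only [one_mul] at h1
  rw [h1]
  exact congrFun (Dcoord_const_mul_comp L hr a' (dcoordEnd k' f)) y

/-- The operator `∑ₖ cₖ ∂ₖ²` on smooth functions. -/
noncomputable def diagOp (c : κ → ℝ) : Module.End ℝ (smoothFun κ) :=
  ∑ k, c k • dcoordEnd k ^ 2

lemma diagOp_apply (c : κ → ℝ) (f : smoothFun κ) (y : κ → ℝ) :
    (diagOp c f : (κ → ℝ) → ℝ) y = ∑ k, c k * Dcoord k (Dcoord k f) y := by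
  simp [diagOp, LinearMap.sum_apply, coe_dcoordEnd_pow]

lemma OpH_iterate_comp {h : ι → ι → ℝ} {L : (ι → ℝ) → (κ → ℝ)} {c : κ → ℝ}
    (hL : ∀ f : smoothFun κ, OpH h (fun y => (f : (κ → ℝ) → ℝ) (L y)) =
      fun y => (diagOp c f : (κ → ℝ) → ℝ) (L y)) (m : ℕ) (f : smoothFun κ) :
    (OpH h)^[m] (fun y => (f : (κ → ℝ) → ℝ) (L y)) =
      fun y => ((diagOp c ^ m) f : (κ → ℝ) → ℝ) (L y) := by
  induction m with
  | zero => rfl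
  | succ m ih => rw [Function.iterate_succ_apply', ih, hL, pow_succ', Module.End.mul_apply]

end

lemma mpart_eq_list_prod (n : ℕ) (β : Fin n → ℕ) (f : smoothFun (Fin n)) :
    mpart n β f =
      (((List.finRange n).map fun k => dcoordEnd k ^ β k).prod f : (Fin n → ℝ) → ℝ) := by
  unfold mpart
  induction List.finRange n with
  | nil => rfl
  | cons k l ih =>
    rw [List.foldr_cons, ih, List.map_cons, List.prod_cons, Module.End.mul_apply,
      coe_dcoordEnd_pow]

lemma list_prod_map_smul {κ A : Type*} [Ring A] [Algebra ℝ A] (c : κ → ℝ) (T : κ → A)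
    (l : List κ) :
    (l.map fun k => c k • T k).prod = (l.map c).prod • (l.map T).prod := by
  induction l with
  | nil => simp
  | cons k l ih => simp [ih, smul_smul, mul_comm]

lemma diagOp_pow_apply (n m : ℕ) (c : Fin n → ℝ) (f : smoothFun (Fin n)) (y : Fin n → ℝ) :
    ((diagOp c ^ m) f : (Fin n → ℝ) → ℝ) y = (Nat.factorial m : ℝ) *
      ∑ α ∈ Finset.Nat.antidiagonalTuple n m,
        (∏ k, (Nat.factorial (α k) : ℝ))⁻¹ * (∏ k, c k ^ α k) *
          mpart n (fun k => 2 * α k) f y := by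
  have hcomm : ((Finset.univ : Finset (Fin n)) : Set (Fin n)).Pairwise
      (Function.onFun Commute fun k => c k • dcoordEnd k ^ 2) := fun k _ k' _ _ =>
    (((dcoordEnd_commute k k').pow_pow 2 2).smul_left _).smul_right _
  have hset : Finset.Nat.antidiagonalTuple n m = Finset.univ.piAntidiag m := by
    ext α
    simp [Finset.Nat.mem_antidiagonalTuple]
  rw [diagOp, Finset.sum_pow_eq_sum_piAntidiag_of_commute _ _ hcomm, hset, LinearMap.sum_apply,
    Submodule.coe_sum, Finset.sum_apply, Finset.mul_sum]
  refine Finset.sum_congr rfl fun α hα => ?_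
  have hsum : ∑ k, α k = m := (Finset.mem_piAntidiag.1 hα).1
  have hmult : (Nat.multinomial Finset.univ α : ℝ) =
      (Nat.factorial m : ℝ) * (∏ k, (Nat.factorial (α k) : ℝ))⁻¹ := by
    rw [eq_mul_inv_iff_mul_eq₀ (Finset.prod_ne_zero_iff.2 fun k _ => by positivity), mul_comm,
      ← hsum]
    exact_mod_cast Nat.multinomial_spec Finset.univ α
  have hprod : ∀ hc, Finset.univ.noncommProd (fun k => (c k • dcoordEnd k ^ 2) ^ α k) hc =
      (∏ k, c k ^ α k) • ((List.finRange n).map fun k => dcoordEnd k ^ (2 * α k)).prod := by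
    intro hc
    have huniv : (Finset.univ : Finset (Fin n)) = (List.finRange n).toFinset := by
      ext; simp
    have h1 := Finset.noncommProd_toFinset (List.finRange n)
      (fun k => (c k • dcoordEnd k ^ 2 : Module.End ℝ (smoothFun (Fin n))) ^ α k)
      (by rw [← huniv]; exact hc) (List.nodup_finRange n)
    simp only [← huniv] at h1
    rw [h1, Fin.prod_univ_def]
    simp only [smul_pow, pow_mul]
    exact list_prod_map_smul (fun k => c k ^ α k)
      (fun k => ((dcoordEnd k : Module.End ℝ (smoothFun (Fin n))) ^ 2) ^ α k) _
  rw [hprod, mpart_eq_list_prod, mul_assoc, ← mul_assoc, ← hmult]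
  simp [← nsmul_eq_mul]

lemma neg_cot_identity {w t s : ℝ} (hw : 0 < w) (ht : Real.sin (w * t) ≠ 0) :
    -(Real.cos (w * t / 2) / Real.sin (w * t / 2)) / (2 * w) *
        ((Real.sin (w * (t - s)) + Real.sin (w * s)) / Real.sin (w * t)) ^ 2
      + 2 * (Real.cos (w * s) / 2) * (Real.sin (w * s) / w)
      - w * (Real.cos (w * t) / Real.sin (w * t)) * (Real.sin (w * s) / w) ^ 2
      = -(Real.cos (w * t / 2) / Real.sin (w * t / 2)) / (2 * w) := by
  have e1 : w * t = 2 * (w * t / 2) := by ring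
  have e2 : w * (t - s) = 2 * (w * t / 2) - w * s := by ring
  rw [e2]
  generalize w * t / 2 = T at *
  rw [e1] at ht ⊢
  generalize w * s = S
  rw [Real.sin_two_mul] at ht
  rw [Real.sin_sub, Real.cos_two_mul', Real.sin_two_mul]
  have hs : Real.sin T ≠ 0 := fun h => ht (by simp [h])
  have hc : Real.cos T ≠ 0 := fun h => ht (by simp [h])
  have hT := Real.sin_sq_add_cos_sq T
  have hS := Real.sin_sq_add_cos_sq S
  generalize Real.sin T = x at *
  generalize Real.cos T = y at *
  generalize Real.sin S = u at *
  generalize Real.cos S = v at *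
  have hX : (2 * x * y * v - (y ^ 2 - x ^ 2) * u + u) / (2 * x * y) = (y * v + x * u) / y := by
    field_simp
    linear_combination (-u) * hT
  rw [hX]
  field_simp
  linear_combination (-(y ^ 2)) * hS

/-- Equation (40) of the paper: with `h` the inverse Hessian `H₁⁻¹` (nonzero entries
`h_{xᵏxᵏ} = −cot(ωₖt/2)/(2ωₖ)`, `h_{zᵏξᵏ} = h_{ξᵏzᵏ} = −1`,
`h_{ξᵏξᵏ} = −ωₖcot(ωₖt)`) and `L` the linear map with `k`-th component
`(cos(ωₖs)/2)zᵏ − (sin(ωₖs)/ωₖ)ξᵏ + ((sin(ωₖ(t−s)) + sin(ωₖs))/sin(ωₖt))xᵏ`,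
one has, for any smooth `W : ℝⁿ → ℝ` and any `j ≥ 0` and point `p`:
`(Σ h_{rr'} ∂_r∂_{r'})^{j+1}(W∘L)(p)
  = (j+1)! Σ_{|α|=j+1} (1/α!) Πₖ(−cot(ωₖt/2)/(2ωₖ))^{αₖ} (∂^{2α}W)(L p)`.
Coordinates of `ℝ^{3n}` are indexed by `Fin n ⊕ Fin n ⊕ Fin n` as `(x, z, ξ)`. -/
theorem stmt_17 (n : ℕ) (hn : 1 ≤ n) (ω : Fin n → ℝ) (hω : ∀ k, 0 < ω k)
    (t s : ℝ) (hsin : ∀ k, Real.sin (ω k * t) ≠ 0)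
    (h : (Fin n ⊕ Fin n ⊕ Fin n) → (Fin n ⊕ Fin n ⊕ Fin n) → ℝ)
    (hh : h = fun r r' =>
      match r, r' with
      | Sum.inl k, Sum.inl k' => if k = k' then
          -(Real.cos (ω k * t / 2) / Real.sin (ω k * t / 2)) / (2 * ω k) else 0
      | Sum.inr (Sum.inl k), Sum.inr (Sum.inr k') => if k = k' then -1 else 0
      | Sum.inr (Sum.inr k), Sum.inr (Sum.inl k') => if k = k' then -1 else 0
      | Sum.inr (Sum.inr k), Sum.inr (Sum.inr k') => if k = k' then
          -(ω k * (Real.cos (ω k * t) / Real.sin (ω k * t))) else 0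
      | _, _ => 0)
    (L : ((Fin n ⊕ Fin n ⊕ Fin n) → ℝ) → (Fin n → ℝ))
    (hL : ∀ (p : (Fin n ⊕ Fin n ⊕ Fin n) → ℝ) (k : Fin n), L p k =
      Real.cos (ω k * s) / 2 * p (Sum.inr (Sum.inl k))
        - Real.sin (ω k * s) / ω k * p (Sum.inr (Sum.inr k))
        + (Real.sin (ω k * (t - s)) + Real.sin (ω k * s)) / Real.sin (ω k * t) *
            p (Sum.inl k))
    (W : (Fin n → ℝ) → ℝ) (hW : ContDiff ℝ (⊤ : ℕ∞) W) (j : ℕ)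
    (p : (Fin n ⊕ Fin n ⊕ Fin n) → ℝ) :
    (OpH h)^[j + 1] (fun y => W (L y)) p
      = (Nat.factorial (j + 1) : ℝ) *
          ∑ α ∈ Finset.Nat.antidiagonalTuple n (j + 1),
            (∏ k, (Nat.factorial (α k) : ℝ))⁻¹ *
            (∏ k, (-(Real.cos (ω k * t / 2) / Real.sin (ω k * t / 2)) /
                (2 * ω k)) ^ (α k)) *
            mpart n (fun k => 2 * α k) W (L p) := by
  set a : Fin n → ℝ := fun k =>
    -(Real.cos (ω k * t / 2) / Real.sin (ω k * t / 2)) / (2 * ω k) with ha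
  have hlin : IsLinearMap ℝ L :=
    ⟨fun x y => by ext k; simp only [hL, Pi.add_apply]; ring,
      fun b x => by ext k; simp only [hL, Pi.smul_apply, smul_eq_mul]; ring⟩
  obtain ⟨M, hM⟩ : ∃ M : ((Fin n ⊕ Fin n ⊕ Fin n) → ℝ) →L[ℝ] (Fin n → ℝ), L = M :=
    ⟨LinearMap.toContinuousLinearMap (hlin.mk' L), rfl⟩
  have hx : ∀ k, M (Pi.single (Sum.inl k) 1) =
      ((Real.sin (ω k * (t - s)) + Real.sin (ω k * s)) / Real.sin (ω k * t)) •
        Pi.single k (1 : ℝ) := by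
    intro k
    ext i
    rw [← hM, hL]
    by_cases hik : i = k
    · subst hik; simp
    · simp [hik]
  have hz : ∀ k, M (Pi.single (Sum.inr (Sum.inl k)) 1) =
      (Real.cos (ω k * s) / 2) • Pi.single k (1 : ℝ) := by
    intro k
    ext i
    rw [← hM, hL]
    by_cases hik : i = k
    · subst hik; simp
    · simp [hik]
  have hξ : ∀ k, M (Pi.single (Sum.inr (Sum.inr k)) 1) =
      (-(Real.sin (ω k * s) / ω k)) • Pi.single k (1 : ℝ) := by
    intro k
    ext i
    rw [← hM, hL]
    by_cases hik : i = k
    · subst hik; simp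
    · simp [hik]
  have hop : ∀ f : smoothFun (Fin n), OpH h (fun y => (f : (Fin n → ℝ) → ℝ) (L y)) =
      fun y => (diagOp a f : (Fin n → ℝ) → ℝ) (L y) := by
    intro f
    funext y
    rw [diagOp_apply, hM]
    simp only [OpH, hh, Fintype.sum_sum_type, ite_mul, zero_mul, Finset.sum_ite_eq,
      Finset.mem_univ, if_true, Finset.sum_const_zero, add_zero, zero_add,
      Dcoord_Dcoord_comp M (hx _) (hx _), Dcoord_Dcoord_comp M (hz _) (hξ _),
      Dcoord_Dcoord_comp M (hξ _) (hz _), Dcoord_Dcoord_comp M (hξ _) (hξ _)]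
    simp only [← Finset.sum_add_distrib]
    refine Finset.sum_congr rfl fun k _ => ?_
    linear_combination
      Dcoord k (Dcoord k f) (M y) * neg_cot_identity (s := s) (hω k) (hsin k)
  have hfinal := congrFun (OpH_iterate_comp hop (j + 1) ⟨W, mem_smoothFun.2 hW⟩) p
  exact hfinal.trans (diagOp_pow_apply n (j + 1) a ⟨W, mem_smoothFun.2 hW⟩ (L p))
end
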